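/- arXiv:1907.11368 — 2 statements merged into one kernel-verified Lean document; each statement's English description precedes it below -/
import Mathlib

section
/- With the walk setup below, let S be the swap operator S|j,k⟩ = |k,j⟩ on ℂ^N ⊗ ℂ^N and let Q be the conditional swap operator defined by Q|j,k⟩ = |k,j⟩ if (j,k) ∈ E and Q|j,k⟩ = |j,k⟩ if (j,k) ∉ E. Set V = iQ(2TT† − 1) and W = iS(2TT† − 1). Then for every natural number τ, V^{2τ} = W^{2τ}. -/
open Matrix

/-- If an involution `s` commutes with an idempotent `c` that annihilates `p` on both sides, then
replacing `s` by the operator that acts trivially on the range of `c` does not change the square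
of `s * (2 * p - 1)`. -/
theorem sq_conditional_involution_mul_reflection {A : Type*} [Ring A] {s c p : A}
    (hss : s * s = 1) (hcs : c * s = s * c) (hcc : c * c = c) (hcp : c * p = 0)
    (hpc : p * c = 0) :
    ((s + (1 - s) * c) * (2 * p - 1)) ^ 2 = (s * (2 * p - 1)) ^ 2 := by
  set r := 2 * p - 1 with hr
  have hcr : c * r = -c := by
    rw [hr, two_mul, mul_sub, mul_add, hcp, mul_one, add_zero, zero_sub]
  have hrc : r * c = -c := by
    rw [hr, two_mul, sub_mul, add_mul, hpc, one_mul, add_zero, zero_sub]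
  clear_value r
  have hb : c * (1 - s) = (1 - s) * c := by rw [mul_sub, sub_mul, hcs, one_mul, mul_one]
  have hs : s * (1 - s) = -(1 - s) := by rw [mul_sub, hss, mul_one, neg_sub]
  have hs' : (1 - s) * s = -(1 - s) := by rw [sub_mul, hss, one_mul, neg_sub]
  have hsum : (s + (1 - s) * c) * r = s * r - (1 - s) * c := by
    rw [add_mul, mul_assoc (1 - s), hcr, mul_neg, ← sub_eq_add_neg]
  have hleft : s * r * ((1 - s) * c) = (1 - s) * c := by
    rw [← hb, mul_assoc s, ← mul_assoc r, hrc, neg_mul, hb, mul_neg, ← mul_assoc, hs, neg_mul,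
      neg_neg]
  have hright : (1 - s) * c * (s * r) = (1 - s) * c := by
    rw [mul_assoc, ← mul_assoc c, hcs, mul_assoc s, hcr, mul_neg, mul_neg, ← mul_assoc, hs',
      neg_mul, neg_neg]
  have hsq : (1 - s) * c * ((1 - s) * c) = (1 - s) * c + (1 - s) * c := by
    rw [mul_assoc, ← mul_assoc c, hb, mul_assoc (1 - s) c c, hcc, ← mul_assoc, mul_sub (1 - s),
      mul_one, hs', sub_neg_eq_add, add_mul]
  rw [hsum, sq, sub_mul, mul_sub, mul_sub, hleft, hright, hsq, ← sq]
  abel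

/-- Walk setup: with `S` the swap and `Q` the conditional swap (swapping `|j,k⟩` only when
`(j,k) ∈ E`), the walk operators `V = iQ(2TT† − 1)` and `W = iS(2TT† − 1)` satisfy
`V^(2τ) = W^(2τ)` for every natural number `τ`. -/
theorem conditional_swap_walk_even_powers_eq {N : ℕ} (hN : 1 ≤ N)
    (E : Fin N → Fin N → Prop) [DecidableRel E]
    (hsymm : ∀ j k, E j k → E k j) (hrefl : ∀ j, E j j)
    (ψ : Fin N → (Fin N × Fin N) → ℂ)
    (horth : ∀ l l' : Fin N,
      (∑ p : Fin N × Fin N, star (ψ l p) * ψ l' p) = if l = l' then 1 else 0)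
    (hsupp : ∀ (l j k : Fin N), (l ≠ j ∨ ¬ E j k) → ψ l (j, k) = 0)
    (T : Matrix (Fin N × Fin N) (Fin N) ℂ) (hT : ∀ p l, T p l = ψ l p)
    (S : Matrix (Fin N × Fin N) (Fin N × Fin N) ℂ)
    (hS : ∀ p q : Fin N × Fin N, S p q = if p = (q.2, q.1) then 1 else 0)
    (Q : Matrix (Fin N × Fin N) (Fin N × Fin N) ℂ)
    (hQ : ∀ p q : Fin N × Fin N, Q p q =
      if E q.1 q.2 then (if p = (q.2, q.1) then 1 else 0)
      else (if p = q then 1 else 0)) :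
    ∀ τ : ℕ,
      (Complex.I • (Q * ((2 : ℂ) • (T * Tᴴ) - 1))) ^ (2 * τ) =
      (Complex.I • (S * ((2 : ℂ) • (T * Tᴴ) - 1))) ^ (2 * τ) := by
  intro τ
  let C : Matrix (Fin N × Fin N) (Fin N × Fin N) ℂ :=
    diagonal fun p => if E p.1 p.2 then 0 else 1
  have hE : ∀ j k, E j k ↔ E k j := fun j k => ⟨hsymm j k, hsymm k j⟩
  have hCT : C * T = 0 := by
    ext ⟨j, k⟩ l
    by_cases h : E j k
    · simp [C, diagonal_mul, h]
    · simp [C, diagonal_mul, h, hT, hsupp l j k (Or.inr h)]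
  have hC : Cᴴ = C := by
    rw [diagonal_conjTranspose]
    congr 1
    ext p
    by_cases h : E p.1 p.2 <;> simp [h]
  have hTC : Tᴴ * C = 0 := by
    rw [← hC, ← conjTranspose_mul, hCT, conjTranspose_zero]
  have hSS : S * S = 1 := by
    ext p q
    simp [mul_apply, hS, one_apply]
  have hCS : C * S = S * C := by
    ext ⟨j, k⟩ ⟨j', k'⟩
    rw [diagonal_mul, mul_diagonal, hS]
    by_cases h : j = k' ∧ k = j'
    · obtain ⟨rfl, rfl⟩ := h
      simp [hE j k]
    · simp [h]
  have hCC : C * C = C := by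
    rw [diagonal_mul_diagonal]
    congr 1
    ext p
    by_cases h : E p.1 p.2 <;> simp [h]
  have hQC : Q = S + (1 - S) * C := by
    ext p q
    rw [Matrix.add_apply, mul_diagonal, Matrix.sub_apply, hQ, hS, one_apply]
    by_cases h : E q.1 q.2 <;> simp [h]
  have hsq : (Q * ((2 : ℂ) • (T * Tᴴ) - 1)) ^ 2 = (S * ((2 : ℂ) • (T * Tᴴ) - 1)) ^ 2 := by
    have h2 : (2 : ℂ) • (T * Tᴴ) = 2 * (T * Tᴴ) := by rw [two_smul, two_mul]
    rw [h2, hQC]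
    exact sq_conditional_involution_mul_reflection hSS hCS hCC
      (by rw [← Matrix.mul_assoc, hCT, Matrix.zero_mul])
      (by rw [Matrix.mul_assoc, hTC, Matrix.mul_zero])
  rw [pow_mul, pow_mul, smul_pow _ (Q * _), smul_pow _ (S * _), hsq]
end

section
/- With the walk setup below, let S be the swap operator S|j,k⟩ = |k,j⟩ and Q the conditional swap Q|j,k⟩ = |k,j⟩ if (j,k) ∈ E, Q|j,k⟩ = |j,k⟩ otherwise. Then for every natural number τ, T† · ((1−iS)/√2) · (iS(2TT†−1))^{2τ} · ((1+iS)/√2) · T = T† · ((1−iQ)/√2) · (iQ(2TT†−1))^{2τ} · ((1+iQ)/√2) · T; moreover each of the operators (1+iQ)/√2, (1−iQ)/√2, iQ, and 2TT†−1 is a C-local unitary with respect to G (viewing |j,k⟩ as having vertex j and internal state k). Hence the discrete-time quantum walk of Childs's correspondence can be implemented, for even numbers of steps, as a product of 2τ + 2 C-local unitaries conjugated by the isometry T. -/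
open Matrix

/-- A matrix `U` indexed by basis states `(j, z)` is `C`-local with respect to the edge
relation `E` if the basis states can be partitioned into blocks (the fibers of a map `p`)
such that (i) `U` has vanishing matrix elements between distinct blocks, and (ii) the
vertices (first coordinates) appearing in each block form a single vertex or a pair of
adjacent vertices. -/
def CLocal {V Z : Type*} (E : V → V → Prop) (U : Matrix (V × Z) (V × Z) ℂ) : Prop :=
  ∃ (ι : Type) (p : V × Z → ι),
    (∀ b b' : V × Z, p b ≠ p b' → U b b' = 0) ∧
    (∀ m : ι,
      (∃ j : V, ∀ b : V × Z, p b = m → b.1 = j) ∨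
      (∃ j k : V, E j k ∧ ∀ b : V × Z, p b = m → b.1 = j ∨ b.1 = k))

/-- `AgreeOn P A B` says that `A` and `B` coincide on the range of `P`, and that `B` commutes
with `P`. -/
def AgreeOn {R : Type*} [Mul R] (P A B : R) : Prop :=
  A * P = B * P ∧ B * P = P * B

namespace AgreeOn

variable {R : Type*} {P A B A' B' : R}

theorem one [Ring R] : AgreeOn P 1 1 := by
  simp [AgreeOn]

theorem mul [Ring R] (h : AgreeOn P A B) (h' : AgreeOn P A' B') :
    AgreeOn P (A * A') (B * B') := by
  refine ⟨?_, ?_⟩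
  · rw [mul_assoc, h'.1, h'.2, ← mul_assoc, h.1, mul_assoc, ← h'.2, mul_assoc]
  · rw [mul_assoc, h'.2, ← mul_assoc, h.2, mul_assoc]

theorem pow [Ring R] (h : AgreeOn P A B) (n : ℕ) : AgreeOn P (A ^ n) (B ^ n) := by
  induction n with
  | zero => simpa using one
  | succ n ih => simpa only [pow_succ] using ih.mul h

theorem add [Ring R] (h : AgreeOn P A B) (h' : AgreeOn P A' B') :
    AgreeOn P (A + A') (B + B') := by
  simp only [AgreeOn, add_mul, mul_add, h.1, h'.1, h.2, h'.2, and_self]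

theorem sub [Ring R] (h : AgreeOn P A B) (h' : AgreeOn P A' B') :
    AgreeOn P (A - A') (B - B') := by
  simp only [AgreeOn, sub_mul, mul_sub, h.1, h'.1, h.2, h'.2, and_self]

theorem smul [Ring R] [Algebra ℂ R] (c : ℂ) (h : AgreeOn P A B) :
    AgreeOn P (c • A) (c • B) := by
  simp only [AgreeOn, smul_mul_assoc, mul_smul_comm, h.1, h.2, and_self]

end AgreeOn

theorem mem_unitary_of_selfAdjoint_involution {R : Type*} [Ring R] [StarRing R] {Q : R}
    (hs : star Q = Q) (hq : Q * Q = 1) :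
    Q ∈ unitary R := by
  rw [Unitary.mem_iff, hs]
  exact ⟨hq, hq⟩

theorem sqrt_two_inv_mul_self : ((Real.sqrt 2 : ℂ)⁻¹ * (Real.sqrt 2 : ℂ)⁻¹) = 2⁻¹ := by
  rw [← mul_inv, ← Complex.ofReal_mul, Real.mul_self_sqrt (by norm_num)]
  norm_num

theorem star_sqrt_two_inv : star ((Real.sqrt 2 : ℂ)⁻¹) = (Real.sqrt 2 : ℂ)⁻¹ := by
  simp

section Unitary

variable {R : Type*} [Ring R] [Algebra ℂ R] {Q : R}

theorem one_add_I_smul_mul_one_sub (hq : Q * Q = 1) :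
    ((Real.sqrt 2 : ℂ)⁻¹ • (1 + Complex.I • Q)) * ((Real.sqrt 2 : ℂ)⁻¹ • (1 - Complex.I • Q))
      = 1 := by
  rw [smul_mul_smul_comm, sqrt_two_inv_mul_self]
  have : (1 + Complex.I • Q) * (1 - Complex.I • Q) = (2 : ℂ) • (1 : R) := by
    simp only [add_mul, mul_sub, one_mul, mul_one, smul_mul_smul_comm, hq, Complex.I_mul_I,
      two_smul, neg_smul, one_smul]
    abel
  rw [this, smul_smul]
  norm_num

theorem one_sub_I_smul_mul_one_add (hq : Q * Q = 1) :
    ((Real.sqrt 2 : ℂ)⁻¹ • (1 - Complex.I • Q)) * ((Real.sqrt 2 : ℂ)⁻¹ • (1 + Complex.I • Q))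
      = 1 := by
  have := one_add_I_smul_mul_one_sub (Q := -Q) (by simpa using hq)
  simpa [sub_eq_add_neg] using this

variable [StarRing R] [StarModule ℂ R]

theorem I_smul_mem_unitary (hs : star Q = Q) (hq : Q * Q = 1) :
    Complex.I • Q ∈ unitary R := by
  rw [Unitary.mem_iff, star_smul, hs]
  simp [smul_smul, hq]

theorem star_one_add_I_smul (hs : star Q = Q) :
    star ((Real.sqrt 2 : ℂ)⁻¹ • (1 + Complex.I • Q)) =
      (Real.sqrt 2 : ℂ)⁻¹ • (1 - Complex.I • Q) := by
  rw [star_smul, star_sqrt_two_inv]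
  simp [hs, sub_eq_add_neg]

theorem one_add_I_smul_mem_unitary (hs : star Q = Q) (hq : Q * Q = 1) :
    (Real.sqrt 2 : ℂ)⁻¹ • (1 + Complex.I • Q) ∈ unitary R := by
  rw [Unitary.mem_iff, star_one_add_I_smul hs]
  exact ⟨one_sub_I_smul_mul_one_add hq, one_add_I_smul_mul_one_sub hq⟩

theorem one_sub_I_smul_mem_unitary (hs : star Q = Q) (hq : Q * Q = 1) :
    (Real.sqrt 2 : ℂ)⁻¹ • (1 - Complex.I • Q) ∈ unitary R := by
  rw [← star_one_add_I_smul hs]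
  exact Unitary.star_mem (one_add_I_smul_mem_unitary hs hq)

end Unitary

/-- A matrix that couples `(j, k)` only to itself and, along edges, to `(k, j)` is C-local. -/
theorem CLocal.of_edge_swap {V : Type} {E : V → V → Prop} (hsymm : ∀ j k, E j k → E k j)
    {U : Matrix (V × V) (V × V) ℂ}
    (hU : ∀ b b' : V × V, b ≠ b' → ¬ (E b'.1 b'.2 ∧ b = (b'.2, b'.1)) → U b b' = 0) :
    CLocal E U := by
  classical
  refine ⟨Sym2 V, fun b => if E b.1 b.2 then s(b.1, b.2) else s(b.1, b.1), ?_, ?_⟩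
  · intro b b' h
    refine hU b b' (fun hb => h (by rw [hb])) ?_
    rintro ⟨he, rfl⟩
    exact h (by simp [he, hsymm _ _ he, Sym2.eq_swap])
  · intro m
    induction m using Sym2.ind with
    | _ x y =>
      by_cases hxy : E x y
      · refine Or.inr ⟨x, y, hxy, ?_⟩
        rintro ⟨j, k⟩ h
        dsimp only at h ⊢
        split_ifs at h <;> simp only [Sym2.eq_iff] at h <;> tauto
      · refine Or.inl ⟨x, ?_⟩
        rintro ⟨j, k⟩ h
        dsimp only at h ⊢
        split_ifs at h with he
        · rcases Sym2.eq_iff.1 h with ⟨rfl, rfl⟩ | ⟨rfl, rfl⟩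
          · rfl
          · exact absurd (hsymm _ _ he) hxy
        · rcases Sym2.eq_iff.1 h with ⟨rfl, -⟩ | ⟨rfl, rfl⟩
          · rfl
          · rfl

/-- A matrix that preserves the vertex is C-local. -/
theorem CLocal.of_fst {V : Type} {Z : Type*} {E : V → V → Prop} {U : Matrix (V × Z) (V × Z) ℂ}
    (hU : ∀ b b' : V × Z, b.1 ≠ b'.1 → U b b' = 0) : CLocal E U :=
  ⟨V, Prod.fst, hU, fun m => Or.inl ⟨m, fun _ h => h⟩⟩

/-- Walk setup: for even numbers of steps, the discrete-time quantum walk of Childs's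
correspondence built from the swap `S` equals the one built from the conditional swap `Q`,
and the operators `(1+iQ)/√2`, `(1−iQ)/√2`, `iQ`, `2TT†−1` are C-local unitaries; hence
the walk can be implemented with `2τ + 2` C-local unitaries conjugated by `T`. -/
theorem walk_is_clocal_implementable {N : ℕ} (hN : 1 ≤ N)
    (E : Fin N → Fin N → Prop) [DecidableRel E]
    (hsymm : ∀ j k, E j k → E k j) (hrefl : ∀ j, E j j)
    (ψ : Fin N → (Fin N × Fin N) → ℂ)
    (horth : ∀ l l' : Fin N,
      (∑ p : Fin N × Fin N, star (ψ l p) * ψ l' p) = if l = l' then 1 else 0)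
    (hsupp : ∀ (l j k : Fin N), (l ≠ j ∨ ¬ E j k) → ψ l (j, k) = 0)
    (T : Matrix (Fin N × Fin N) (Fin N) ℂ) (hT : ∀ p l, T p l = ψ l p)
    (S : Matrix (Fin N × Fin N) (Fin N × Fin N) ℂ)
    (hS : ∀ p q : Fin N × Fin N, S p q = if p = (q.2, q.1) then 1 else 0)
    (Q : Matrix (Fin N × Fin N) (Fin N × Fin N) ℂ)
    (hQ : ∀ p q : Fin N × Fin N, Q p q =
      if E q.1 q.2 then (if p = (q.2, q.1) then 1 else 0)
      else (if p = q then 1 else 0)) :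
    (∀ τ : ℕ,
      Tᴴ * ((Real.sqrt 2 : ℂ)⁻¹ • (1 - Complex.I • S)) *
          (Complex.I • (S * ((2 : ℂ) • (T * Tᴴ) - 1))) ^ (2 * τ) *
          ((Real.sqrt 2 : ℂ)⁻¹ • (1 + Complex.I • S)) * T =
      Tᴴ * ((Real.sqrt 2 : ℂ)⁻¹ • (1 - Complex.I • Q)) *
          (Complex.I • (Q * ((2 : ℂ) • (T * Tᴴ) - 1))) ^ (2 * τ) *
          ((Real.sqrt 2 : ℂ)⁻¹ • (1 + Complex.I • Q)) * T) ∧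
    (((Real.sqrt 2 : ℂ)⁻¹ • (1 + Complex.I • Q)) ∈
        Matrix.unitaryGroup (Fin N × Fin N) ℂ ∧
      CLocal E ((Real.sqrt 2 : ℂ)⁻¹ • (1 + Complex.I • Q))) ∧
    (((Real.sqrt 2 : ℂ)⁻¹ • (1 - Complex.I • Q)) ∈
        Matrix.unitaryGroup (Fin N × Fin N) ℂ ∧
      CLocal E ((Real.sqrt 2 : ℂ)⁻¹ • (1 - Complex.I • Q))) ∧
    ((Complex.I • Q) ∈ Matrix.unitaryGroup (Fin N × Fin N) ℂ ∧
      CLocal E (Complex.I • Q)) ∧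
    (((2 : ℂ) • (T * Tᴴ) - 1) ∈ Matrix.unitaryGroup (Fin N × Fin N) ℂ ∧
      CLocal E ((2 : ℂ) • (T * Tᴴ) - 1)) := by
  have hTT : Tᴴ * T = 1 := by
    ext l l'
    simp only [mul_apply, conjTranspose_apply, hT, horth, one_apply]
  have hQs : star Q = Q := by
    ext ⟨a, b⟩ ⟨c, d⟩
    have := hsymm a b
    have := hsymm c d
    simp only [star_apply, hQ, Prod.mk.injEq]
    split_ifs <;> simp <;> grind
  have hQval : ∀ (M : Matrix (Fin N × Fin N) (Fin N × Fin N) ℂ) (p q : Fin N × Fin N),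
      (M * Q) p q = if E q.1 q.2 then M p (q.2, q.1) else M p q := by
    intro M p q
    simp only [mul_apply, hQ]
    split_ifs <;> simp
  have hQQ : Q * Q = 1 := by
    ext ⟨a, b⟩ ⟨c, d⟩
    have := hsymm c d
    rw [hQval]
    simp only [hQ, one_apply]
    split_ifs <;> grind
  set P : Matrix (Fin N × Fin N) (Fin N × Fin N) ℂ :=
    diagonal fun p => if E p.1 p.2 then 1 else 0 with hP
  have hPT : P * T = T := by
    ext ⟨j, k⟩ l
    rw [hP, diagonal_mul, hT]
    by_cases h : E j k
    · simp [h]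
    · simp [h, hsupp l j k (Or.inr h)]
  have hTP : Tᴴ * P = Tᴴ := by
    have hPs : Pᴴ = P := by
      rw [hP, diagonal_conjTranspose]
      congr 1
      ext p
      simp only [Pi.star_apply]
      split_ifs <;> simp
    have := congrArg conjTranspose hPT
    rwa [conjTranspose_mul, hPs] at this
  have hSQ : AgreeOn P S Q := by
    constructor
    · ext p q
      simp only [hP, mul_diagonal, hS, hQ]
      split_ifs <;> simp
    · ext ⟨a, b⟩ ⟨c, d⟩
      have := hsymm c d
      simp only [hP, mul_diagonal, diagonal_mul, hQ]
      split_ifs <;> simp <;> grind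
  have hD : AgreeOn P ((2 : ℂ) • (T * Tᴴ) - 1) ((2 : ℂ) • (T * Tᴴ) - 1) := by
    refine (AgreeOn.smul 2 ⟨rfl, ?_⟩).sub AgreeOn.one
    rw [Matrix.mul_assoc, hTP, ← Matrix.mul_assoc, hPT]
  have hDs : star ((2 : ℂ) • (T * Tᴴ) - 1) = (2 : ℂ) • (T * Tᴴ) - 1 := by
    rw [star_sub, star_smul, star_one, star_eq_conjTranspose (T * Tᴴ), conjTranspose_mul,
      conjTranspose_conjTranspose]
    simp
  have hDD : ((2 : ℂ) • (T * Tᴴ) - 1) * ((2 : ℂ) • (T * Tᴴ) - 1) = 1 := by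
    have h : T * Tᴴ * (T * Tᴴ) = T * Tᴴ := by
      rw [Matrix.mul_assoc, ← Matrix.mul_assoc Tᴴ, hTT, Matrix.one_mul]
    simp only [sub_mul, mul_sub, mul_one, one_mul, smul_mul_smul_comm, h]
    module
  refine ⟨fun τ => ?_, ⟨one_add_I_smul_mem_unitary hQs hQQ, ?_⟩,
    ⟨one_sub_I_smul_mem_unitary hQs hQQ, ?_⟩, ⟨I_smul_mem_unitary hQs hQQ, ?_⟩,
    ⟨mem_unitary_of_selfAdjoint_involution hDs hDD, ?_⟩⟩
  · have h := (((AgreeOn.one.sub (hSQ.smul Complex.I)).smul (Real.sqrt 2 : ℂ)⁻¹).mul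
      (((hSQ.mul hD).smul Complex.I).pow (2 * τ))).mul
      ((AgreeOn.one.add (hSQ.smul Complex.I)).smul (Real.sqrt 2 : ℂ)⁻¹)
    have := congrArg (fun M => Tᴴ * (M * T)) h.1
    simpa only [Matrix.mul_assoc, hPT] using this
  · refine CLocal.of_edge_swap hsymm fun b b' h h' => ?_
    simp [hQ, one_apply, h]
    tauto
  · refine CLocal.of_edge_swap hsymm fun b b' h h' => ?_
    simp [hQ, one_apply, h]
    tauto
  · refine CLocal.of_edge_swap hsymm fun b b' h h' => ?_
    simp [hQ, h]
    tauto
  · refine CLocal.of_fst fun b b' h => ?_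
    have h0 : (T * Tᴴ) b b' = 0 := by
      rw [mul_apply]
      refine Finset.sum_eq_zero fun l _ => ?_
      rw [conjTranspose_apply, hT, hT]
      by_cases hl : l = b.1
      · rw [hsupp l b'.1 b'.2 (Or.inl fun h' => h (hl.symm.trans h')), star_zero, mul_zero]
      · rw [hsupp l b.1 b.2 (Or.inl hl), zero_mul]
    have hb : b ≠ b' := fun hb => h (by rw [hb])
    simp [h0, one_apply, hb]
end
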